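/- Let G be a finite non-abelian group that has an abelian normal subgroup of prime index, and suppose that |G/Z(G)| = p^r for some prime p and integer r with G/Z(G) non-abelian. Then |Cent(G)| = p^{r-1} + 2. -/

import Mathlib

/-- The set of element centralizers of a group `G`. -/
def Cent (G : Type*) [Group G] : Set (Subgroup G) :=
  Set.range fun x : G => Subgroup.centralizer {x}

section AbelianNormalPrimeIndex

open Subgroup

variable {G : Type*} [Group G] {N : Subgroup G}

theorem exists_zpow_mul_of_prime_index (hN : N.Normal) (hidx : N.index.Prime) {x : G}
    (hx : x ∉ N) (u : G) : ∃ k : ℤ, ∃ n ∈ N, u = x ^ k * n := by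
  have := Fact.mk hidx
  have hx' : (x : G ⧸ N) ≠ 1 := fun h => hx ((QuotientGroup.eq_one_iff x).1 h)
  obtain ⟨k, hk⟩ := mem_zpowers_iff.1 (mem_zpowers_of_prime_card (p := N.index)
    (g := (x : G ⧸ N)) (g' := (u : G ⧸ N)) N.index_eq_card.symm hx')
  refine ⟨k, (x ^ k)⁻¹ * u, ?_, by group⟩
  rw [← QuotientGroup.eq, QuotientGroup.mk_zpow, hk]

theorem eq_top_of_le_of_not_mem_of_prime_index (hN : N.Normal) (hidx : N.index.Prime)
    {H : Subgroup G} (hle : N ≤ H) {x : G} (hxH : x ∈ H) (hxN : x ∉ N) : H = ⊤ := by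
  refine eq_top_iff.2 fun u _ => ?_
  obtain ⟨k, n, hn, rfl⟩ := exists_zpow_mul_of_prime_index hN hidx hxN u
  exact H.mul_mem (H.zpow_mem hxH k) (hle hn)

theorem centralizer_singleton_eq_top_iff {x : G} : centralizer {x} = ⊤ ↔ x ∈ center G := by
  rw [centralizer_eq_top_iff_subset, Set.singleton_subset_iff, SetLike.mem_coe]

theorem le_centralizer_singleton_of_abelian (hab : ∀ x ∈ N, ∀ y ∈ N, x * y = y * x) {x : G}
    (hx : x ∈ N) : N ≤ centralizer {x} :=
  fun y hy => mem_centralizer_singleton_iff.2 (hab y hy x hx)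

theorem mem_center_of_mem_centralizer_of_prime_index (hN : N.Normal)
    (hab : ∀ x ∈ N, ∀ y ∈ N, x * y = y * x) (hidx : N.index.Prime) {x n : G} (hx : x ∉ N)
    (hn : n ∈ N) (h : n ∈ centralizer {x}) : n ∈ center G := by
  refine centralizer_singleton_eq_top_iff.1 (eq_top_of_le_of_not_mem_of_prime_index hN hidx
    (le_centralizer_singleton_of_abelian hab hn) (mem_centralizer_singleton_iff.2 ?_) hx)
  exact (mem_centralizer_singleton_iff.1 h).symm

theorem center_le_of_prime_index (hna : ¬ ∀ a b : G, a * b = b * a) (hN : N.Normal)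
    (hab : ∀ x ∈ N, ∀ y ∈ N, x * y = y * x) (hidx : N.index.Prime) : center G ≤ N := by
  intro z hz
  by_contra hzN
  have key : ∀ n ∈ N, n ∈ center G := fun n hn =>
    mem_center_of_mem_centralizer_of_prime_index hN hab hidx hzN hn
      (mem_centralizer_singleton_iff.2 (mem_center_iff.1 hz n))
  have htop := eq_top_of_le_of_not_mem_of_prime_index hN hidx key hz hzN
  exact hna fun a b => mem_center_iff.1 (htop ▸ mem_top b) a

theorem centralizer_le_of_mem_centralizer_of_prime_index (hN : N.Normal)
    (hab : ∀ x ∈ N, ∀ y ∈ N, x * y = y * x) (hidx : N.index.Prime) {x y : G} (hx : x ∉ N)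
    (hy : y ∉ N) (h : y ∈ centralizer {x}) : centralizer {x} ≤ centralizer {y} := by
  intro u hu
  obtain ⟨k, n, hn, rfl⟩ := exists_zpow_mul_of_prime_index hN hidx hy u
  have hnx : n ∈ centralizer {x} :=
    ((centralizer {x}).mul_mem_cancel_left (zpow_mem h k)).1 hu
  have hnz := mem_center_of_mem_centralizer_of_prime_index hN hab hidx hx hn hnx
  exact mul_mem (zpow_mem (mem_centralizer_singleton_iff.2 rfl) k)
    (center_le_centralizer _ hnz)

theorem centralizer_eq_of_mem_centralizer_of_prime_index (hN : N.Normal)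
    (hab : ∀ x ∈ N, ∀ y ∈ N, x * y = y * x) (hidx : N.index.Prime) {x y : G} (hx : x ∉ N)
    (hy : y ∉ N) (h : y ∈ centralizer {x}) : centralizer {x} = centralizer {y} :=
  le_antisymm (centralizer_le_of_mem_centralizer_of_prime_index hN hab hidx hx hy h)
    (centralizer_le_of_mem_centralizer_of_prime_index hN hab hidx hy hx
      (mem_centralizer_singleton_iff.2 (mem_centralizer_singleton_iff.1 h).symm))

theorem centralizer_mul_left_eq_iff_of_prime_index (hN : N.Normal)
    (hab : ∀ x ∈ N, ∀ y ∈ N, x * y = y * x) (hidx : N.index.Prime) {g a b : G} (hg : g ∉ N)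
    (ha : a ∈ N) (hb : b ∈ N) :
    centralizer {g * a} = centralizer {g * b} ↔ a⁻¹ * b ∈ center G := by
  have hga : g * a ∉ N := fun h => hg ((N.mul_mem_cancel_right ha).1 h)
  have hgb : g * b ∉ N := fun h => hg ((N.mul_mem_cancel_right hb).1 h)
  have hab' : g * b = g * a * (a⁻¹ * b) := by group
  have hself : g * a ∈ centralizer {g * a} := mem_centralizer_singleton_iff.2 rfl
  constructor
  · intro h
    refine mem_center_of_mem_centralizer_of_prime_index hN hab hidx hga
      (mul_mem (inv_mem ha) hb) (((centralizer {g * a}).mul_mem_cancel_left hself).1 ?_)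
    rw [← hab', h]
    exact mem_centralizer_singleton_iff.2 rfl
  · intro h
    refine centralizer_eq_of_mem_centralizer_of_prime_index hN hab hidx hga hgb ?_
    rw [hab']
    exact mul_mem hself (center_le_centralizer _ h)

theorem exists_centralizer_mul_left_eq_of_prime_index (hN : N.Normal)
    (hab : ∀ x ∈ N, ∀ y ∈ N, x * y = y * x) (hidx : N.index.Prime) {g x : G} (hg : g ∉ N)
    (hx : x ∉ N) : ∃ a ∈ N, centralizer {g * a} = centralizer {x} := by
  obtain ⟨k, n, hn, rfl⟩ := exists_zpow_mul_of_prime_index hN hidx hx g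
  refine ⟨n⁻¹, inv_mem hn, ?_⟩
  rw [mul_inv_cancel_right]
  exact (centralizer_eq_of_mem_centralizer_of_prime_index hN hab hidx hx
    (fun h => hg (mul_mem h hn)) (zpow_mem (mem_centralizer_singleton_iff.2 rfl) k)).symm

theorem exists_mem_not_mem_center_of_prime_index (hna : ¬ ∀ a b : G, a * b = b * a)
    (hN : N.Normal) (hidx : N.index.Prime) : ∃ n ∈ N, n ∉ center G := by
  by_contra! hle
  apply hna
  by_contra! h
  obtain ⟨a, b, h⟩ := h
  have ha : a ∉ N := fun ha => h (mem_center_iff.1 (hle a ha) b).symm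
  obtain ⟨k, n, hn, rfl⟩ := exists_zpow_mul_of_prime_index hN hidx ha b
  refine h (mem_centralizer_singleton_iff.1 (?_ : a ^ k * n ∈ centralizer {a})).symm
  exact mul_mem (zpow_mem (mem_centralizer_singleton_iff.2 rfl) k)
    (center_le_centralizer _ (hle n hn))

theorem Cent_eq_of_prime_index (hna : ¬ ∀ a b : G, a * b = b * a) (hN : N.Normal)
    (hab : ∀ x ∈ N, ∀ y ∈ N, x * y = y * x) (hidx : N.index.Prime) {g : G} (hg : g ∉ N) :
    Cent G = insert ⊤ (insert N ((fun a => centralizer {g * a}) '' (N : Set G))) := by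
  have hcent : ∀ n ∈ N, n ∉ center G → centralizer {n} = N := by
    intro n hn hnz
    refine le_antisymm (fun u hu => ?_) (le_centralizer_singleton_of_abelian hab hn)
    by_contra huN
    exact hnz (centralizer_singleton_eq_top_iff.1 (eq_top_of_le_of_not_mem_of_prime_index
      hN hidx (le_centralizer_singleton_of_abelian hab hn) hu huN))
  ext H
  constructor
  · rintro ⟨x, rfl⟩
    by_cases hxz : x ∈ center G
    · exact Or.inl (centralizer_singleton_eq_top_iff.2 hxz)
    · by_cases hx : x ∈ N
      · exact Or.inr (Or.inl (hcent x hx hxz))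
      · exact Or.inr (Or.inr (exists_centralizer_mul_left_eq_of_prime_index hN hab hidx hg hx))
  · rintro (rfl | rfl | ⟨a, -, rfl⟩)
    · exact ⟨1, centralizer_singleton_eq_top_iff.2 (one_mem _)⟩
    · obtain ⟨n, hn, hnz⟩ := exists_mem_not_mem_center_of_prime_index hna hN hidx
      exact ⟨n, hcent n hn hnz⟩
    · exact ⟨g * a, rfl⟩

theorem ncard_centralizer_image_of_prime_index (hN : N.Normal)
    (hab : ∀ x ∈ N, ∀ y ∈ N, x * y = y * x) (hidx : N.index.Prime) {g : G} (hg : g ∉ N) :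
    ((fun a => centralizer {g * a}) '' (N : Set G)).ncard = (center G).relIndex N := by
  have hiff : ∀ a b : N, centralizer {g * (a : G)} = centralizer {g * (b : G)} ↔
      a⁻¹ * b ∈ (center G).subgroupOf N := fun a b =>
    centralizer_mul_left_eq_iff_of_prime_index hN hab hidx hg a.2 b.2
  let f : N ⧸ (center G).subgroupOf N → Subgroup G :=
    Quotient.lift (fun a : N => centralizer {g * (a : G)}) fun a b h =>
      (hiff a b).2 (QuotientGroup.leftRel_apply.1 h)
  have hf : Function.Injective f := by
    rintro ⟨a⟩ ⟨b⟩ h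
    exact QuotientGroup.eq.2 ((hiff a b).1 h)
  have hrange : (fun a => centralizer {g * a}) '' (N : Set G) = Set.range f := by
    ext H
    constructor
    · rintro ⟨a, ha, rfl⟩
      exact ⟨QuotientGroup.mk ⟨a, ha⟩, rfl⟩
    · rintro ⟨⟨a⟩, rfl⟩
      exact ⟨a, a.2, rfl⟩
  rw [hrange, relIndex, index_eq_card, ← Nat.card_coe_set_eq, Nat.card_range_of_injective hf]

theorem ncard_Cent_of_prime_index [Finite G] (hna : ¬ ∀ a b : G, a * b = b * a) (hN : N.Normal)
    (hab : ∀ x ∈ N, ∀ y ∈ N, x * y = y * x) (hidx : N.index.Prime) :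
    (Cent G).ncard = (center G).relIndex N + 2 := by
  have hNtop : N ≠ ⊤ := fun h => hidx.ne_one (index_eq_one.2 h)
  obtain ⟨g, hg⟩ : ∃ g, g ∉ N := by
    by_contra! h
    exact hNtop (eq_top_iff.2 fun x _ => h x)
  have hgN : ∀ a ∈ N, g * a ∉ N := fun a ha h => hg ((N.mul_mem_cancel_right ha).1 h)
  rw [Cent_eq_of_prime_index hna hN hab hidx hg, Set.ncard_insert_of_notMem,
    Set.ncard_insert_of_notMem, ncard_centralizer_image_of_prime_index hN hab hidx hg]
  · rintro ⟨a, ha, h : centralizer {g * a} = N⟩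
    refine hgN a ha (h.le ?_)
    exact mem_centralizer_singleton_iff.2 rfl
  · rintro (h | ⟨a, ha, h⟩)
    · exact hNtop h.symm
    · exact hgN a ha (center_le_of_prime_index hna hN hab hidx
        (centralizer_singleton_eq_top_iff.1 h))

end AbelianNormalPrimeIndex

/-- If a finite non-abelian group `G` has an abelian normal subgroup of prime index and
`G/Z(G)` is non-abelian of order `p^r`, then `|Cent(G)| = p^(r-1) + 2`. -/
theorem card_cent_eq_of_abelian_normal_prime_index (G : Type*) [Group G] [Finite G]
    (hna : ¬ ∀ a b : G, a * b = b * a)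
    (N : Subgroup G) (hN : N.Normal)
    (hab : ∀ x ∈ N, ∀ y ∈ N, x * y = y * x)
    (hidx : N.index.Prime)
    (p r : ℕ) (hp : p.Prime)
    (hcard : Nat.card (G ⧸ Subgroup.center G) = p ^ r)
    (hqna : ¬ ∀ a b : G ⧸ Subgroup.center G, a * b = b * a) :
    (Cent G).ncard = p ^ (r - 1) + 2 := by
  have hmul : (Subgroup.center G).relIndex N * N.index = p ^ r := by
    rw [← hcard, ← Subgroup.index_eq_card]
    exact Subgroup.relIndex_mul_index (center_le_of_prime_index hna hN hab hidx)
  have hidxp : N.index = p :=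
    (Nat.prime_dvd_prime_iff_eq hidx hp).1 (hidx.dvd_of_dvd_pow (Dvd.intro_left _ hmul))
  rw [ncard_Cent_of_prime_index hna hN hab hidx, Nat.add_right_cancel_iff]
  cases r with
  | zero => exact absurd (Nat.eq_one_of_mul_eq_one_left hmul) hidx.ne_one
  | succ r =>
    rw [hidxp, pow_succ] at hmul
    exact Nat.eq_of_mul_eq_mul_right hp.pos hmul
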